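/- Let α ∈ (0,1], δ > 0, u > 0 and τ ≥ 0. Then (u − δτ u^{1−α})₊ ≤ ((u^α − δατ)₊)^{1/α} ≤ (u − δατ u^{1−α})₊, where s₊ = max(s,0). -/

import Mathlib

open Set

/-- **Two-sided bounds for the damped value (proof of Lemma 5.2).**  For `α ∈ (0,1]`,
`δ > 0`, `u > 0` and `τ ≥ 0`,
`(u − δτ u^{1−α})₊ ≤ ((u^α − δατ)₊)^{1/α} ≤ (u − δατ u^{1−α})₊`,
where `s₊ = max(s,0)`. -/
theorem damped_value_bounds
    (α δ u τ : ℝ) (hα : α ∈ Set.Ioc (0:ℝ) 1) (hδ : 0 < δ) (hu : 0 < u) (hτ : 0 ≤ τ) :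
    max (u - δ * τ * u ^ (1 - α)) 0 ≤ (max (u ^ α - δ * α * τ) 0) ^ (1/α) ∧
    (max (u ^ α - δ * α * τ) 0) ^ (1/α) ≤ max (u - δ * α * τ * u ^ (1 - α)) 0 := by
  obtain ⟨hα0, hα1⟩ := hα
  have h1 : (1:ℝ) ≤ 1 / α := (one_le_div hα0).2 hα1
  have hup : 0 < u ^ α := Real.rpow_pos_of_pos hu α
  set t := δ * τ / u ^ α with ht
  have hdt : δ * τ = t * u ^ α := by rw [ht]; field_simp
  have ht0 : 0 ≤ t := by positivity
  have hmul : u ^ α * u ^ (1 - α) = u := by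
    rw [← Real.rpow_add hu, add_sub_cancel, Real.rpow_one]
  set m := max (1 - α * t) 0 with hm
  have hm0 : 0 ≤ m := le_max_right _ _
  have hm1 : m ≤ 1 := max_le (by nlinarith) zero_le_one
  have hL : u - δ * τ * u ^ (1 - α) = u * (1 - t) := by
    linear_combination -u ^ (1 - α) * hdt - t * hmul
  have hR : max (u - δ * α * τ * u ^ (1 - α)) 0 = u * m := by
    rw [hm, mul_max_of_nonneg _ _ hu.le, mul_zero]
    congr 1
    linear_combination -α * u ^ (1 - α) * hdt - α * t * hmul
  have hM : (max (u ^ α - δ * α * τ) 0) ^ (1 / α) = u * m ^ (1 / α) := by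
    have h : max (u ^ α - δ * α * τ) 0 = u ^ α * m := by
      rw [hm, mul_max_of_nonneg _ _ hup.le, mul_zero]
      congr 1
      linear_combination -α * hdt
    rw [h, Real.mul_rpow hup.le hm0, ← Real.rpow_mul hu.le, mul_one_div_cancel hα0.ne',
      Real.rpow_one]
  rw [hL, hR, hM]
  refine ⟨max_le ?_ (by positivity), ?_⟩
  · refine mul_le_mul_of_nonneg_left ?_ hu.le
    have hB := one_add_mul_self_le_rpow_one_add (s := m - 1) (by linarith) h1
    rw [add_sub_cancel] at hB
    refine le_trans ?_ hB
    have h2 : 1 / α * (-(α * t)) ≤ 1 / α * (m - 1) :=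
      mul_le_mul_of_nonneg_left (by linarith [le_max_left (1 - α * t) 0]) (by positivity)
    have h3 : 1 / α * (-(α * t)) = -t := by field_simp
    linarith
  · exact mul_le_mul_of_nonneg_left (Real.rpow_le_self_of_le_one hm0 hm1 h1) hu.le
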